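/- Let σ > 0, m ∈ ℕ, and a, b : Fin m → ℝ. For c : Fin m → ℝ let Lap_σ^m(c) denote the product measure on (Fin m → ℝ) whose i-th factor is the measure on ℝ with density x ↦ (1/(2σ))·exp(−|x − c i|/σ) with respect to Lebesgue measure. Then for every measurable set Z ⊆ (Fin m → ℝ), Lap_σ^m(a)(Z) ≤ exp((∑_{i} |a i − b i|)/σ) · Lap_σ^m(b)(Z). -/

import Mathlib

open MeasureTheory

/-- The product Laplace measure `Lap_σ^m(c)` on `Fin m → ℝ`: the product measure whose
i-th factor is the measure on ℝ with density `x ↦ (1/(2σ))·exp(−|x − c i|/σ)`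
with respect to Lebesgue measure. -/
noncomputable def lapPi (σ : ℝ) {m : ℕ} (c : Fin m → ℝ) : Measure (Fin m → ℝ) :=
  Measure.pi fun i =>
    volume.withDensity fun x => ENNReal.ofReal ((1 / (2 * σ)) * Real.exp (-|x - c i| / σ))

open scoped ENNReal

/-- Domination of measures up to a constant passes to finite product measures, the constants
being multiplied. -/
theorem MeasureTheory.Measure.pi_le_prod_smul_pi {ι : Type*} [Fintype ι] {α : ι → Type*}
    [∀ i, MeasurableSpace (α i)] {μ ν : ∀ i, Measure (α i)} {k : ι → ℝ≥0∞}
    (hk : ∀ i, k i ≠ 0) (hk' : ∀ i, k i ≠ ∞) (h : ∀ i, μ i ≤ k i • ν i) :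
    Measure.pi μ ≤ (∏ i, k i) • Measure.pi ν := by
  have hK : ∏ i, k i ≠ 0 := Finset.prod_ne_zero_iff.2 fun i _ => hk i
  have hK' : ∏ i, k i ≠ ∞ := ENNReal.prod_ne_top fun i _ => hk' i
  have hpi : (∏ i, k i)⁻¹ • OuterMeasure.pi (fun i => (μ i).toOuterMeasure) ≤
      OuterMeasure.pi fun i => (ν i).toOuterMeasure := by
    refine OuterMeasure.le_pi.2 fun s _ => ?_
    rw [_root_.smul_apply, smul_eq_mul, ENNReal.inv_mul_le_iff hK hK']
    calc _ ≤ ∏ i, μ i (s i) := OuterMeasure.pi_pi_le _ s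
      _ ≤ ∏ i, k i * ν i (s i) := Finset.prod_le_prod' fun i _ => h i (s i)
      _ = _ := Finset.prod_mul_distrib
  refine Measure.le_iff.2 fun Z hZ => ?_
  have hZ' := hpi Z
  rw [_root_.smul_apply, smul_eq_mul, ENNReal.inv_mul_le_iff hK hK'] at hZ'
  rwa [Measure.smul_apply, smul_eq_mul, Measure.pi_def, Measure.pi_def,
    toMeasure_apply _ _ hZ, toMeasure_apply _ _ hZ]

/-- The Laplace densities centred at `a` and `b` have ratio at most `exp (|a - b| / σ)`. -/
theorem laplace_density_le {σ : ℝ} (hσ : 0 < σ) (a b x : ℝ) :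
    (1 / (2 * σ)) * Real.exp (-|x - a| / σ) ≤
      Real.exp (|a - b| / σ) * ((1 / (2 * σ)) * Real.exp (-|x - b| / σ)) := by
  rw [mul_left_comm, ← Real.exp_add, ← add_div]
  gcongr
  linarith [abs_sub_le x a b]

/-- Multidimensional Laplace mechanism guarantee: for every measurable
`Z ⊆ (Fin m → ℝ)`, `Lap_σ^m(a)(Z) ≤ exp((∑_i |a i − b i|)/σ) · Lap_σ^m(b)(Z)`. -/
theorem laplace_mechanism_multi_dim (σ : ℝ) (hσ : 0 < σ) (m : ℕ) (a b : Fin m → ℝ)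
    (Z : Set (Fin m → ℝ)) (hZ : MeasurableSet Z) :
    lapPi σ a Z ≤ ENNReal.ofReal (Real.exp ((∑ i, |a i - b i|) / σ)) * lapPi σ b Z := by
  have hprod : ENNReal.ofReal (Real.exp ((∑ i, |a i - b i|) / σ)) =
      ∏ i, ENNReal.ofReal (Real.exp (|a i - b i| / σ)) := by
    rw [Finset.sum_div, Real.exp_sum, ENNReal.ofReal_prod_of_nonneg fun i _ => (Real.exp_pos _).le]
  rw [hprod]
  refine Measure.pi_le_prod_smul_pi (fun i => (ENNReal.ofReal_pos.2 (Real.exp_pos _)).ne')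
    (fun i => ENNReal.ofReal_ne_top) (fun i => ?_) Z
  rw [← withDensity_smul _ (by fun_prop)]
  refine withDensity_mono (ae_of_all _ fun x => ?_)
  rw [Pi.smul_apply, smul_eq_mul, ← ENNReal.ofReal_mul (Real.exp_pos _).le]
  exact ENNReal.ofReal_le_ofReal (laplace_density_le hσ (a i) (b i) x)
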